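/- Suppose that for given m ≥ 1 and d ≥ 2 there exist m-stiff configurations on S^d of cardinalities N_1 and N_2. Then there exists an m-stiff configuration on S^d of cardinality N_1 + N_2. -/

import Mathlib

open MeasureTheory Metric
open scoped RealInnerProductSpace

noncomputable section

/-- `E n` is the Euclidean space `ℝ^n`; the unit sphere `S^{n-1}` is `Metric.sphere (0 : E n) 1`. -/
abbrev E (n : ℕ) : Type := EuclideanSpace ℝ (Fin n)

/-- The surface area measure on the unit sphere of `ℝ^n`, normalized to be a probability
measure. -/
noncomputable def sphereUnif (n : ℕ) : Measure (sphere (0 : E n) 1) :=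
  (((volume : Measure (E n)).toSphere) Set.univ)⁻¹ • (volume : Measure (E n)).toSphere

/-- `X` is a spherical `k`-design on the unit sphere of `ℝ^n`: all its points lie on the sphere
and every polynomial of total degree at most `k` has average over `X` equal to its average over
the sphere (with respect to the normalized surface area measure). -/
def IsSphericalDesign (n k : ℕ) (X : Finset (E n)) : Prop :=
  (↑X : Set (E n)) ⊆ sphere (0 : E n) 1 ∧
    ∀ p : MvPolynomial (Fin n) ℝ, p.totalDegree ≤ k →
      (∑ x ∈ X, MvPolynomial.eval (fun i => x i) p) / (X.card : ℝ) =
        ∫ y, MvPolynomial.eval (fun i => (y : E n) i) p ∂(sphereUnif n)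

/-- `Dm n m X` is the set of points `z` of the unit sphere of `ℝ^n` forming at most `m`
distinct dot products with the points of `X`. -/
def Dm (n m : ℕ) (X : Set (E n)) : Set (E n) :=
  {z | z ∈ sphere (0 : E n) 1 ∧ ∃ T : Finset ℝ, T.card ≤ m ∧ ∀ x ∈ X, ⟪z, x⟫ ∈ T}

/-- `X` is an `m`-stiff configuration on the unit sphere of `ℝ^n`: it is a spherical
`(2m-1)`-design and some point of the sphere forms at most `m` distinct dot products with the
points of `X`. -/
def IsStiff (n m : ℕ) (X : Finset (E n)) : Prop :=
  IsSphericalDesign n (2 * m - 1) X ∧ (Dm n m ↑X).Nonempty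

open Polynomial in
theorem aeval_linear_totalDegree {n : ℕ} (L : MvPolynomial (Fin n) ℝ) (hL : L.totalDegree ≤ 1)
    (f : ℝ[X]) : (Polynomial.aeval L f).totalDegree ≤ f.natDegree := by
  rw [Polynomial.aeval_eq_sum_range]
  refine MvPolynomial.totalDegree_finsetSum_le fun i hi => ?_
  refine (MvPolynomial.totalDegree_smul_le _ _).trans ?_
  refine (MvPolynomial.totalDegree_pow _ _).trans ?_
  have : i ≤ f.natDegree := Nat.lt_succ_iff.1 (Finset.mem_range.1 hi)
  nlinarith

theorem bind_linear_totalDegree {n : ℕ} (L : Fin n → MvPolynomial (Fin n) ℝ)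
    (hL : ∀ i, (L i).totalDegree ≤ 1)
    (p : MvPolynomial (Fin n) ℝ) : (MvPolynomial.bind₁ L p).totalDegree ≤ p.totalDegree := by
  rw [MvPolynomial.bind₁, MvPolynomial.aeval_def, MvPolynomial.eval₂_eq]
  refine MvPolynomial.totalDegree_finsetSum_le fun s hs => ?_
  refine (MvPolynomial.totalDegree_mul _ _).trans ?_
  rw [MvPolynomial.algebraMap_eq, MvPolynomial.totalDegree_C, zero_add]
  refine (MvPolynomial.totalDegree_finsetProd _ _).trans ?_
  refine le_trans ?_ (MvPolynomial.le_totalDegree hs)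
  refine Finset.sum_le_sum fun i _ => ?_
  refine (MvPolynomial.totalDegree_pow _ _).trans ?_
  have := hL i
  nlinarith

/-- The linear form `x ↦ ⟪z, x⟫` as a polynomial. -/
def linForm {n : ℕ} (z : E n) : MvPolynomial (Fin n) ℝ :=
  ∑ i, MvPolynomial.C (z i) * MvPolynomial.X i

theorem linForm_eval {n : ℕ} (z x : E n) :
    MvPolynomial.eval (fun i => x i) (linForm z) = ⟪z, x⟫ := by
  simp [linForm, PiLp.inner_apply, mul_comm]

theorem linForm_totalDegree {n : ℕ} (z : E n) : (linForm z).totalDegree ≤ 1 := by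
  refine MvPolynomial.totalDegree_finsetSum_le fun s hs => ?_
  refine (MvPolynomial.totalDegree_mul _ _).trans ?_
  rw [MvPolynomial.totalDegree_C, MvPolynomial.totalDegree_X]

theorem aeval_linForm_eval {n : ℕ} (z x : E n) (f : Polynomial ℝ) :
    MvPolynomial.eval (fun i => x i) (Polynomial.aeval (linForm z) f) = f.eval ⟪z, x⟫ := by
  rw [← linForm_eval, Polynomial.aeval_def, Polynomial.hom_eval₂, Polynomial.eval]
  congr 1
  ext; simp

theorem design_vanish {n k : ℕ} {X : Finset (E n)} (hX : IsSphericalDesign n k X) (z : E n)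
    (f : Polynomial ℝ) (hf : f.natDegree ≤ k) (h0 : ∀ x ∈ X, f.eval ⟪z, x⟫ = 0) :
    ∫ y : sphere (0 : E n) 1, f.eval ⟪z, (y : E n)⟫ ∂(sphereUnif n) = 0 := by
  have := hX.2 (Polynomial.aeval (linForm z) f)
    ((aeval_linear_totalDegree _ (linForm_totalDegree z) f).trans hf)
  simp only [aeval_linForm_eval] at this
  rw [← this, Finset.sum_eq_zero h0, zero_div]

theorem sphereUnif_finite (n : ℕ) : IsFiniteMeasure (sphereUnif (n + 1)) := by
  constructor
  have h : ((volume : Measure (E (n+1))).toSphere) Set.univ ≠ 0 := by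
    rw [Ne, Measure.measure_univ_eq_zero]
    exact Measure.toSphere_ne_zero _
  simp only [sphereUnif, Measure.smul_apply, smul_eq_mul]
  exact ENNReal.mul_lt_top (ENNReal.inv_lt_top.2 (pos_iff_ne_zero.2 h)) (measure_lt_top _ _)

theorem sphereUnif_openPos (n : ℕ) : (sphereUnif n).IsOpenPosMeasure := by
  constructor
  intro U hU hne
  simp only [sphereUnif, Measure.smul_apply, smul_eq_mul]
  refine mul_ne_zero (ENNReal.inv_ne_zero.2 (measure_ne_top _ _)) (hU.measure_ne_zero _ hne)

theorem cont_eval {n : ℕ} (z : E n) (f : Polynomial ℝ) :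
    Continuous fun y : sphere (0 : E n) 1 => f.eval ⟪z, (y : E n)⟫ := by
  have := f.continuous
  fun_prop

theorem integrable_eval {n : ℕ} (z : E (n + 1)) (f : Polynomial ℝ) :
    Integrable (fun y : sphere (0 : E (n + 1)) 1 => f.eval ⟪z, (y : E (n + 1))⟫)
      (sphereUnif (n + 1)) := by
  have := sphereUnif_finite n
  exact (cont_eval z f).integrable_of_hasCompactSupport (HasCompactSupport.of_compactSpace _)

theorem poly_zero_of_integral {d : ℕ} (hd : 2 ≤ d) (z : E (d + 1)) (hz : ‖z‖ = 1)
    (f : Polynomial ℝ) (hf : ∀ t, -1 ≤ t → t ≤ 1 → 0 ≤ f.eval t)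
    (hi : ∫ y : sphere (0 : E (d + 1)) 1, f.eval ⟪z, (y : E (d + 1))⟫ ∂(sphereUnif (d + 1)) = 0) :
    f = 0 := by
  have := sphereUnif_openPos (d + 1)
  have hb : ∀ y : sphere (0 : E (d + 1)) 1, |⟪z, (y : E (d + 1))⟫| ≤ 1 := fun y => by
    have h1 := abs_real_inner_le_norm z (y : E (d + 1))
    have h2 : ‖(y : E (d + 1))‖ = 1 := by simp
    rwa [hz, h2, one_mul] at h1
  have hnn : 0 ≤ fun y : sphere (0 : E (d + 1)) 1 => f.eval ⟪z, (y : E (d + 1))⟫ :=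
    fun y => hf _ (abs_le.1 (hb y)).1 (abs_le.1 (hb y)).2
  have h1 := (integral_eq_zero_iff_of_nonneg hnn (integrable_eval z f)).1 hi
  have h2 := (Continuous.ae_eq_iff_eq _ (cont_eval z f) continuous_const).1 h1
  have hpc : IsPreconnected (sphere (0 : E (d + 1)) 1) := by
    refine isPreconnected_sphere ?_ _ _
    rw [rank_eq_card_basis (EuclideanSpace.basisFun (Fin (d + 1)) ℝ).toBasis]
    simp only [Fintype.card_fin]
    exact_mod_cast (by omega : 1 < d + 1)
  have hiv := hpc.intermediate_value (a := -z) (b := z) (f := fun y => ⟪z, y⟫)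
    (by simp [hz]) (by simp [hz]) (by fun_prop)
  simp only [inner_neg_right, real_inner_self_eq_norm_sq, hz, one_pow] at hiv
  refine Polynomial.eq_zero_of_infinite_isRoot f
    (Set.Infinite.mono ?_ (Set.Icc_infinite (by norm_num : (-1 : ℝ) < 1)))
  intro t ht
  obtain ⟨y, hy, rfl⟩ := hiv ht
  exact congrFun h2 ⟨y, hy⟩

/-- The node polynomial. -/
def nodeP (T : Finset ℝ) : Polynomial ℝ := ∏ t ∈ T, (Polynomial.X - Polynomial.C t)

theorem nodeP_monic (T : Finset ℝ) : (nodeP T).Monic := Polynomial.monic_prod_X_sub_C _ _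

theorem nodeP_natDegree (T : Finset ℝ) : (nodeP T).natDegree = T.card := by
  simp [nodeP]

theorem nodeP_eval (T : Finset ℝ) (t : ℝ) : (nodeP T).eval t = 0 ↔ t ∈ T := by
  simp [nodeP, Polynomial.eval_prod, Finset.prod_eq_zero_iff, sub_eq_zero]

theorem node_orth {n m : ℕ} {X : Finset (E n)} (hX : IsSphericalDesign n (2 * m - 1) X)
    (hm : 1 ≤ m) (z : E n) (T : Finset ℝ) (hT : T.card = m) (hTX : ∀ x ∈ X, ⟪z, x⟫ ∈ T)
    (h : Polynomial ℝ) (hh : h.natDegree ≤ m - 1) :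
    ∫ y : sphere (0 : E n) 1, (nodeP T * h).eval ⟪z, (y : E n)⟫ ∂(sphereUnif n) = 0 := by
  refine design_vanish hX z _ ?_ ?_
  · refine Polynomial.natDegree_mul_le.trans ?_
    rw [nodeP_natDegree]; omega
  · intro x hx
    rw [Polynomial.eval_mul, (nodeP_eval _ _).2 (hTX x hx), zero_mul]

theorem nodes_unique {d m : ℕ} (hd : 2 ≤ d) (hm : 1 ≤ m) {X Y : Finset (E (d + 1))}
    (hX : IsSphericalDesign (d + 1) (2 * m - 1) X) (hY : IsSphericalDesign (d + 1) (2 * m - 1) Y)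
    (z : E (d + 1)) (hz : ‖z‖ = 1) (T S : Finset ℝ) (hT : T.card = m) (hS : S.card = m)
    (hTX : ∀ x ∈ X, ⟪z, x⟫ ∈ T) (hSY : ∀ x ∈ Y, ⟪z, x⟫ ∈ S) : T = S := by
  have hdeg : (nodeP T - nodeP S).natDegree ≤ m - 1 := by
    have h1 : (nodeP T - nodeP S).degree < (nodeP T).degree := by
      apply Polynomial.degree_sub_lt_left
      · rw [Polynomial.degree_eq_natDegree (nodeP_monic T).ne_zero,
          Polynomial.degree_eq_natDegree (nodeP_monic S).ne_zero, nodeP_natDegree,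
          nodeP_natDegree, hT, hS]
      · exact (nodeP_monic T).ne_zero
      · rw [(nodeP_monic T).leadingCoeff, (nodeP_monic S).leadingCoeff]
    rw [Polynomial.degree_eq_natDegree (nodeP_monic T).ne_zero, nodeP_natDegree, hT] at h1
    by_cases h0 : nodeP T - nodeP S = 0
    · simp [h0]
    · have := (Polynomial.natDegree_lt_iff_degree_lt h0).2 h1
      omega
  have h1 := node_orth hX hm z T hT hTX _ hdeg
  have h2 := node_orth hY hm z S hS hSY _ hdeg
  have h3 := poly_zero_of_integral hd z hz ((nodeP T - nodeP S) ^ 2)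
    (fun t _ _ => by rw [Polynomial.eval_pow]; positivity) (by
      have h5 := integral_sub (integrable_eval z (nodeP T * (nodeP T - nodeP S)))
        (integrable_eval z (nodeP S * (nodeP T - nodeP S)))
      rw [h1, h2, sub_self] at h5
      rw [← h5]
      congr 1
      ext y
      simp only [Polynomial.eval_pow, Polynomial.eval_sub, Polynomial.eval_mul]
      ring)
  have h4 : nodeP T = nodeP S := sub_eq_zero.1 (pow_eq_zero_iff (two_ne_zero) |>.1 h3)
  ext t
  rw [← nodeP_eval, ← nodeP_eval, h4]

theorem node_ne {d m : ℕ} (hd : 2 ≤ d) (hm : 1 ≤ m) {X : Finset (E (d + 1))}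
    (hX : IsSphericalDesign (d + 1) (2 * m - 1) X)
    (z : E (d + 1)) (hz : ‖z‖ = 1) (T : Finset ℝ) (hT : T.card = m)
    (hTX : ∀ x ∈ X, ⟪z, x⟫ ∈ T) (s : ℝ) (hs : s = 1 ∨ s = -1) : s ∉ T := by
  intro hsT
  have hfac : nodeP T = (Polynomial.X - Polynomial.C s) * nodeP (T.erase s) :=
    (Finset.mul_prod_erase T _ hsT).symm
  have h1 := node_orth hX hm z T hT hTX (nodeP (T.erase s))
    (by rw [nodeP_natDegree, Finset.card_erase_of_mem hsT, hT])
  have h2 := poly_zero_of_integral hd z hz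
    (Polynomial.C (-s) * (nodeP T * nodeP (T.erase s)))
    (fun t ht1 ht2 => by
      rw [hfac]
      simp only [Polynomial.eval_mul, Polynomial.eval_sub, Polynomial.eval_X, Polynomial.eval_C]
      have : 0 ≤ -s * (t - s) := by rcases hs with rfl | rfl <;> linarith
      have h5 := mul_nonneg this (mul_self_nonneg ((nodeP (T.erase s)).eval t))
      nlinarith)
    (by
      simp only [Polynomial.eval_mul (p := Polynomial.C (-s)), Polynomial.eval_C]
      rw [integral_const_mul, h1, mul_zero])
  have hs0 : -s ≠ 0 := by rcases hs with rfl | rfl <;> norm_num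
  exact mul_ne_zero (Polynomial.C_ne_zero.2 hs0)
    (mul_ne_zero (nodeP_monic T).ne_zero (nodeP_monic _).ne_zero) h2

/-- The action of a linear isometry on the unit sphere. -/
def sphereMap {n : ℕ} (R : E n ≃ₗᵢ[ℝ] E n) (y : sphere (0 : E n) 1) : sphere (0 : E n) 1 :=
  ⟨R y, by simp⟩

theorem sphereMap_cont {n : ℕ} (R : E n ≃ₗᵢ[ℝ] E n) : Continuous (sphereMap R) := by
  unfold sphereMap
  have := R.continuous
  fun_prop

open scoped Pointwise in
theorem toSphere_map {n : ℕ} (R : E n ≃ₗᵢ[ℝ] E n) :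
    ((volume : Measure (E n)).toSphere).map (sphereMap R) = (volume : Measure (E n)).toSphere := by
  ext s hs
  have hm := (sphereMap_cont R).measurable
  rw [Measure.map_apply hm hs, Measure.toSphere_apply' _ hs, Measure.toSphere_apply' _ (hm hs)]
  congr 1
  have hvol : ∀ A : Set (E n), volume (R ⁻¹' A) = volume A := fun A =>
    MeasurePreserving.measure_preimage_equiv (f := R.toMeasurableEquiv) R.measurePreserving A
  rw [← hvol (Set.Ioo (0 : ℝ) 1 • (Subtype.val '' s))]
  congr 1
  ext x
  simp only [Set.mem_smul, Set.mem_image, Set.mem_preimage]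
  constructor
  · rintro ⟨r, hr, _, ⟨y, hy, rfl⟩, rfl⟩
    exact ⟨r, hr, _, ⟨_, hy, rfl⟩, by simp [sphereMap]⟩
  · rintro ⟨r, hr, _, ⟨y, hy, rfl⟩, h⟩
    refine ⟨r, hr, _, ⟨sphereMap R.symm y, ?_, rfl⟩, ?_⟩
    · simpa [sphereMap] using hy
    · apply R.injective
      simpa [sphereMap] using h

theorem integral_rot {n : ℕ} (R : E n ≃ₗᵢ[ℝ] E n) (g : sphere (0 : E n) 1 → ℝ)
    (hg : Continuous g) :
    ∫ y, g (sphereMap R y) ∂(sphereUnif n) = ∫ y, g y ∂(sphereUnif n) := by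
  have : sphereUnif n = (sphereUnif n).map (sphereMap R) := by
    rw [sphereUnif, Measure.map_smul, toSphere_map]
  conv_rhs => rw [this]
  rw [integral_map (sphereMap_cont R).measurable.aemeasurable hg.aestronglyMeasurable]

theorem design_rot {n k : ℕ} {X : Finset (E n)} (hX : IsSphericalDesign n k X)
    (R : E n ≃ₗᵢ[ℝ] E n) :
    IsSphericalDesign n k (X.map R.toEquiv.toEmbedding) := by
  refine ⟨?_, ?_⟩
  · intro x hx
    simp only [Finset.coe_map, Set.mem_image] at hx
    obtain ⟨y, hy, rfl⟩ := hx
    have := hX.1 hy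
    simpa using this
  · intro p hp
    let L : Fin n → MvPolynomial (Fin n) ℝ :=
      fun i => linForm (R.symm (EuclideanSpace.single i 1))
    have hL : ∀ x : E n, MvPolynomial.eval (fun i => x i) (MvPolynomial.bind₁ L p) =
        MvPolynomial.eval (fun i => (R x) i) p := by
      intro x
      have h1 : ∀ i, MvPolynomial.eval (fun i => x i) (L i) = (R x) i := by
        intro i
        rw [linForm_eval, ← R.inner_map_map, R.apply_symm_apply]
        simp [EuclideanSpace.inner_single_left]
      rw [← MvPolynomial.coe_aeval_eq_eval, RingHom.coe_coe, MvPolynomial.aeval_bind₁]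
      simp only [MvPolynomial.coe_aeval_eq_eval, h1, MvPolynomial.aeval_eq_eval]
    have h2 := hX.2 (MvPolynomial.bind₁ L p)
      ((bind_linear_totalDegree L (fun i => linForm_totalDegree _) p).trans hp)
    simp only [hL] at h2
    rw [Finset.sum_map, Finset.card_map]
    refine h2.trans ?_
    refine integral_rot R (fun y => MvPolynomial.eval (fun i => (y : E n) i) p) ?_
    exact (MvPolynomial.continuous_eval p).comp (by fun_prop)

theorem exists_disjoint {d : ℕ} (hd : 2 ≤ d) (X Y : Finset (E (d + 1))) (z : E (d + 1))
    (hz : ‖z‖ = 1) (hY : ∀ y ∈ Y, y ∉ Submodule.span ℝ {z}) :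
    ∃ R : E (d + 1) ≃ₗᵢ[ℝ] E (d + 1), R z = z ∧
      Disjoint X (Y.map R.toEquiv.toEmbedding) := by
  classical
  let W : Submodule ℝ (E (d + 1)) := (Submodule.span ℝ {z})ᗮ
  have hz0 : z ≠ 0 := by rintro rfl; simp at hz
  have hW : Module.finrank ℝ W = d := by
    have : Fact (Module.finrank ℝ (E (d + 1)) = d + 1) := ⟨by simp⟩
    exact Submodule.finrank_orthogonal_span_singleton hz0
  let A : Finset (Submodule ℝ W) :=
    Y.image (fun y => ((Submodule.span ℝ {y})ᗮ).comap W.subtype) ∪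
      (X ×ˢ Y).image (fun q => (Submodule.span ℝ {q.2 - q.1}).comap W.subtype)
  have hA : ⊤ ∉ A := by
    intro h
    rcases Finset.mem_union.1 h with h | h
    · obtain ⟨y, hy, hy2⟩ := Finset.mem_image.1 h
      rw [Submodule.comap_subtype_eq_top] at hy2
      apply hY y hy
      have := Submodule.orthogonal_le hy2
      rw [Submodule.orthogonal_orthogonal, Submodule.orthogonal_orthogonal] at this
      exact this (Submodule.mem_span_singleton_self y)
    · obtain ⟨q, hq, hq2⟩ := Finset.mem_image.1 h
      rw [Submodule.comap_subtype_eq_top] at hq2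
      have h1 := Submodule.finrank_mono hq2
      have h2 : Module.finrank ℝ (Submodule.span ℝ {q.2 - q.1}) ≤ 1 := by
        simpa using finrank_span_le_card (R := ℝ) ({q.2 - q.1} : Set (E (d + 1)))
      change Module.finrank ℝ W ≤ _ at h1
      omega
  have hne := Subspace.biUnion_ne_univ_of_top_notMem hA
  obtain ⟨u, hu⟩ := (Set.ne_univ_iff_exists_notMem _).1 hne
  simp only [Set.mem_iUnion, not_exists] at hu
  refine ⟨((Submodule.span ℝ {(u : E (d + 1))})ᗮ).reflection, ?_, ?_⟩
  · apply Submodule.reflection_mem_subspace_eq_self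
    rw [Submodule.mem_orthogonal_singleton_iff_inner_right]
    exact (Submodule.mem_orthogonal_singleton_iff_inner_left).1 u.2
  · rw [Finset.disjoint_left]
    intro x hx hx2
    obtain ⟨y, hy, hyx⟩ := Finset.mem_map.1 hx2
    replace hyx : ((Submodule.span ℝ {(u : E (d + 1))})ᗮ).reflection y = x := hyx
    rw [Submodule.reflection_orthogonal_apply, Submodule.reflection_singleton_apply] at hyx
    have hu1 : ⟪(u : E (d + 1)), y⟫ ≠ 0 := by
      intro h0
      refine hu _ (Finset.mem_union_left _ (Finset.mem_image_of_mem _ hy)) ?_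
      simp only [SetLike.mem_coe, Submodule.mem_comap, Submodule.subtype_apply]
      rwa [Submodule.mem_orthogonal_singleton_iff_inner_left]
    have hu0 : ‖(u : E (d + 1))‖ ≠ 0 := by
      intro h
      rw [norm_eq_zero] at h
      rw [h, inner_zero_left] at hu1
      exact hu1 rfl
    refine hu _ (Finset.mem_union_right _
      (Finset.mem_image_of_mem _ (Finset.mk_mem_product hx hy))) ?_
    simp only [SetLike.mem_coe, Submodule.mem_comap, Submodule.subtype_apply]
    rw [Submodule.mem_span_singleton]
    set c : ℝ := ⟪(u : E (d + 1)), y⟫ / ‖(u : E (d + 1))‖ ^ 2 with hc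
    have hc0 : c ≠ 0 := div_ne_zero hu1 (pow_ne_zero _ hu0)
    have h3 : y - x = (2 * c) • (u : E (d + 1)) := by
      rw [← hyx]
      simp only [RCLike.ofReal_real_eq_id, id_eq, ← hc]
      module
    refine ⟨(2 * c)⁻¹, ?_⟩
    rw [h3, smul_smul, inv_mul_cancel₀ (mul_ne_zero two_ne_zero hc0), one_smul]

/-- Proposition 6.7: if for given `m ≥ 1` and `d ≥ 2` there exist `m`-stiff configurations on
`S^d` of cardinalities `N₁` and `N₂`, then there exists one of cardinality `N₁ + N₂`. -/
theorem stiff_cardinalities_semigroup (m d N₁ N₂ : ℕ) (hm : 1 ≤ m) (hd : 2 ≤ d)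
    (h₁ : ∃ X : Finset (E (d + 1)), X.card = N₁ ∧ IsStiff (d + 1) m X)
    (h₂ : ∃ X : Finset (E (d + 1)), X.card = N₂ ∧ IsStiff (d + 1) m X) :
    ∃ X : Finset (E (d + 1)), X.card = N₁ + N₂ ∧ IsStiff (d + 1) m X := by
  classical
  rcases Nat.eq_zero_or_pos N₁ with rfl | hN₁
  · simpa using h₂
  rcases Nat.eq_zero_or_pos N₂ with rfl | hN₂
  · simpa using h₁
  obtain ⟨X, hXc, hX, z, hz, T₀, hT₀, hTX₀⟩ := h₁
  obtain ⟨Y₀, hYc, hY₀, w, hw, S₀, hS₀, hSY₀⟩ := h₂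
  obtain ⟨T, hTT, hT⟩ := Infinite.exists_superset_card_eq T₀ m hT₀
  obtain ⟨S, hSS, hS⟩ := Infinite.exists_superset_card_eq S₀ m hS₀
  have hz1 : ‖z‖ = 1 := by simpa using hz
  have hw1 : ‖w‖ = 1 := by simpa using hw
  have hTX : ∀ x ∈ X, ⟪z, x⟫ ∈ T := fun x hx => hTT (hTX₀ x hx)
  -- move `w` to `z`
  let Q : E (d + 1) ≃ₗᵢ[ℝ] E (d + 1) := ((Submodule.span ℝ {w - z})ᗮ).reflection
  have hQ : Q w = z := Submodule.reflection_sub (hw1.trans hz1.symm)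
  set Y := Y₀.map Q.toEquiv.toEmbedding with hYdef
  have hY : IsSphericalDesign (d + 1) (2 * m - 1) Y := design_rot hY₀ Q
  have hSY : ∀ y ∈ Y, ⟪z, y⟫ ∈ S := by
    intro y hy
    obtain ⟨y', hy', rfl⟩ := Finset.mem_map.1 hy
    have : ⟪z, Q y'⟫ = ⟪w, y'⟫ := by rw [← hQ, Q.inner_map_map]
    change ⟪z, Q y'⟫ ∈ S
    rw [this]
    exact hSS (hSY₀ y' hy')
  have hTS : T = S := nodes_unique hd hm hX hY z hz1 T S hT hS hTX hSY
  subst hTS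
  have hYz : ∀ y ∈ Y, y ∉ Submodule.span ℝ {z} := by
    intro y hy hmem
    obtain ⟨c, rfl⟩ := Submodule.mem_span_singleton.1 hmem
    have h1 := hSY _ hy
    have h2 : ‖c • z‖ = 1 := by simpa using hY.1 hy
    rw [norm_smul, hz1, mul_one, Real.norm_eq_abs] at h2
    rw [inner_smul_right, real_inner_self_eq_norm_sq, hz1, one_pow, mul_one] at h1
    exact node_ne hd hm hX z hz1 T hT hTX c (eq_or_eq_neg_of_abs_eq h2) h1
  obtain ⟨R, hRz, hdisj⟩ := exists_disjoint hd X Y z hz1 hYz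
  have hRY := design_rot hY R
  set Y' := Y.map R.toEquiv.toEmbedding with hY'def
  have hc : Y'.card = N₂ := by rw [hY'def, Finset.card_map, hYdef, Finset.card_map, hYc]
  have hcU : (X ∪ Y').card = N₁ + N₂ := by rw [Finset.card_union_of_disjoint hdisj, hXc, hc]
  refine ⟨X ∪ Y', hcU, ⟨?_, ?_⟩, z, hz, T, hT.le, ?_⟩
  · rw [Finset.coe_union]
    exact Set.union_subset hX.1 hRY.1
  · intro p hp
    have e1 := hX.2 p hp
    have e2 := hRY.2 p hp
    have p1 : (N₁ : ℝ) ≠ 0 := by exact_mod_cast hN₁.ne'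
    have p2 : (N₂ : ℝ) ≠ 0 := by exact_mod_cast hN₂.ne'
    have p3 : (N₁ : ℝ) + N₂ ≠ 0 := by exact_mod_cast (by omega : N₁ + N₂ ≠ 0)
    rw [hXc, div_eq_iff p1] at e1
    rw [hc, div_eq_iff p2] at e2
    rw [hcU, Finset.sum_union hdisj, e1, e2, Nat.cast_add, div_eq_iff p3]
    ring
  · intro x hx
    rcases Finset.mem_union.1 (Finset.mem_coe.1 hx) with h | h
    · exact hTX x h
    · obtain ⟨y, hy, rfl⟩ := Finset.mem_map.1 h
      change ⟪z, R y⟫ ∈ T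
      have : ⟪z, R y⟫ = ⟪z, y⟫ := by
        conv_lhs => rw [← hRz]
        rw [R.inner_map_map]
      rw [this]
      exact hSY y hy
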